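/- Let K be a quadratic number field with discriminant q and let χ_q be the Kronecker symbol modulo q. Then for Re(s) > 1, ζ_K(s) = ζ(s)·L(s, χ_q), where ζ is the Riemann zeta function and L(s,χ_q) = ∑_{n≥1} χ_q(n)/n^s. -/

import Mathlib

open scoped Classical

open NumberField

/-- The Kronecker symbol `(a | n)` for `n ≥ 1`: completely multiplicative in `n`,
given on odd primes by the Legendre symbol and at `2` by the usual rule. -/
noncomputable def kroneckerSym (a : ℤ) (n : ℕ) : ℤ :=
  ((n.primeFactorsList).map (fun p =>
    if hp : p.Prime then
      (if p = 2 then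
        (if a % 2 = 0 then 0 else if a % 8 = 1 ∨ a % 8 = 7 then 1 else -1)
      else @legendreSym p ⟨hp⟩ a)
    else 0)).prod

/-- The Dedekind zeta function `ζ_K(s) = ∑_{I ≠ 0} N(I)^{−s}`. -/
noncomputable def zetaK (K : Type*) [Field K] [NumberField K] (s : ℂ) : ℂ :=
  ∑' I : {I : Ideal (𝓞 K) // I ≠ ⊥}, (Ideal.absNorm I.1 : ℂ) ^ (-s)


section QuadraticAux

set_option linter.unusedSectionVars false

variable {K : Type*} [Field K] [NumberField K]

lemma qf_exists_basis (hK : Module.finrank ℚ K = 2) :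
    ∃ b : Module.Basis (Fin 2) ℤ (𝓞 K), b 0 = 1 := by
  have hfr : Module.finrank ℤ (𝓞 K) = 2 := by rw [RingOfIntegers.rank, hK]
  let b := Module.finBasisOfFinrankEq ℤ (𝓞 K) hfr
  have h1 : (1 : 𝓞 K) = (b.repr 1 0) • b 0 + (b.repr 1 1) • b 1 := by
    have := (b.sum_repr 1).symm
    rwa [Fin.sum_univ_two] at this
  set x := b.repr 1 0
  set y := b.repr 1 1
  have hcop : IsCoprime x y := by
    rw [Int.isCoprime_iff_gcd_eq_one]
    by_contra hg
    obtain ⟨p, hp, hpd⟩ := Nat.exists_prime_and_dvd hg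
    have hx : (p : ℤ) ∣ x := (Int.natCast_dvd_natCast.mpr hpd).trans (Int.gcd_dvd_left _ _)
    have hy : (p : ℤ) ∣ y := (Int.natCast_dvd_natCast.mpr hpd).trans (Int.gcd_dvd_right _ _)
    obtain ⟨x', hx'⟩ := hx
    obtain ⟨y', hy'⟩ := hy
    have h2 : (1 : 𝓞 K) = (p : 𝓞 K) * (x' • b 0 + y' • b 1) := by
      rw [h1, hx', hy']
      simp only [zsmul_eq_mul]
      push_cast
      ring
    have h3 : Ideal.span {(p : 𝓞 K)} = ⊤ := by
      rw [Ideal.span_singleton_eq_top]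
      exact IsUnit.of_mul_eq_one _ h2.symm
    have h4 := Ideal.absNorm_span_natCast (S := 𝓞 K) p
    rw [h3, Ideal.absNorm_top, hfr] at h4
    have := hp.two_le
    nlinarith
  obtain ⟨u, v, huv⟩ := hcop
  have huv' : (u : 𝓞 K) * x + v * y = 1 := by exact_mod_cast huv
  let w : 𝓞 K := -v • b 0 + u • b 1
  have hb0 : b 0 = u • (1 : 𝓞 K) + (-y) • w := by
    rw [h1]
    simp only [w, zsmul_eq_mul]
    push_cast
    linear_combination (- b 0) * huv'
  have hb1 : b 1 = v • (1 : 𝓞 K) + x • w := by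
    rw [h1]
    simp only [w, zsmul_eq_mul]
    push_cast
    linear_combination (- b 1) * huv'
  let g : Fin 2 → 𝓞 K := ![1, w]
  have hspan : ⊤ ≤ Submodule.span ℤ (Set.range g) := by
    rw [← b.span_eq, Submodule.span_le]
    have m0 : (1 : 𝓞 K) ∈ Submodule.span ℤ (Set.range g) := Submodule.subset_span ⟨0, rfl⟩
    have m1 : w ∈ Submodule.span ℤ (Set.range g) := Submodule.subset_span ⟨1, rfl⟩
    rintro _ ⟨i, rfl⟩
    fin_cases i
    · change b 0 ∈ _
      rw [hb0]
      exact Submodule.add_mem _ (Submodule.smul_mem _ _ m0) (Submodule.smul_mem _ _ m1)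
    · change b 1 ∈ _
      rw [hb1]
      exact Submodule.add_mem _ (Submodule.smul_mem _ _ m0) (Submodule.smul_mem _ _ m1)
  have hli : LinearIndependent ℤ g :=
    linearIndependent_of_top_le_span_of_card_eq_finrank hspan (by simp [hfr])
  refine ⟨Module.Basis.mk hli hspan, ?_⟩
  simp [g]

lemma qf_discr (b : Module.Basis (Fin 2) ℤ (𝓞 K)) (hb : b 0 = 1) :
    ∃ t n : ℤ, b 1 * b 1 = t * b 1 - n ∧ NumberField.discr K = t ^ 2 - 4 * n := by
  have h1 : b 1 * b 1 = (b.repr (b 1 * b 1) 0) • b 0 + (b.repr (b 1 * b 1) 1) • b 1 := by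
    have := (b.sum_repr (b 1 * b 1)).symm
    rwa [Fin.sum_univ_two] at this
  generalize b.repr (b 1 * b 1) 0 = m at h1
  generalize b.repr (b 1 * b 1) 1 = t at h1
  refine ⟨t, -m, by rw [h1, hb]; simp only [zsmul_eq_mul]; push_cast; ring, ?_⟩
  have tr1 : Algebra.trace ℤ (𝓞 K) 1 = 2 := by
    rw [Algebra.trace_eq_matrix_trace b, map_one, Matrix.trace_one]; rfl
  have trw : Algebra.trace ℤ (𝓞 K) (b 1) = t := by
    rw [Algebra.trace_eq_matrix_trace b, Matrix.trace_fin_two, Algebra.leftMulMatrix_eq_repr_mul,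
      Algebra.leftMulMatrix_eq_repr_mul, h1, hb, mul_one]
    rw [← hb]
    simp [-zsmul_eq_mul]
  have trww : Algebra.trace ℤ (𝓞 K) (b 1 * b 1) = 2 * m + t * t := by
    rw [h1, hb, map_add, map_smul, map_smul, tr1, trw]
    simp; ring
  rw [← NumberField.discr_eq_discr K b, Algebra.discr_def, Matrix.det_fin_two]
  simp only [Algebra.traceMatrix_apply, Algebra.traceForm_apply, hb, one_mul, mul_one, tr1, trw, trww]
  ring

lemma qf_repr (b : Module.Basis (Fin 2) ℤ (𝓞 K)) (hb : b 0 = 1) (x : 𝓞 K) :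
    x = (b.repr x 0 : 𝓞 K) + (b.repr x 1 : 𝓞 K) * b 1 := by
  have := (b.sum_repr x).symm
  rw [Fin.sum_univ_two, hb] at this
  simpa only [zsmul_eq_mul, mul_one] using this

lemma qf_repr_mk (b : Module.Basis (Fin 2) ℤ (𝓞 K)) (hb : b 0 = 1) (u v : ℤ) :
    b.repr ((u : 𝓞 K) + v * b 1) 0 = u ∧ b.repr ((u : 𝓞 K) + v * b 1) 1 = v := by
  have : (u : 𝓞 K) + v * b 1 = u • b 0 + v • b 1 := by
    simp [hb]
  rw [this]
  simp [-zsmul_eq_mul]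

/-- The ring homomorphism `𝓞 K → ZMod p` attached to a root of the quadratic polynomial. -/
lemma qf_hom (b : Module.Basis (Fin 2) ℤ (𝓞 K)) (hb : b 0 = 1) {t n : ℤ}
    (h : b 1 * b 1 = t * b 1 - n) (p : ℕ) (r : ZMod p) (hr : r * r = t * r - n) :
    ∃ f : 𝓞 K →+* ZMod p, f (b 1) = r := by
  have key : ∀ x y : 𝓞 K, b.repr (x * y) 0 = b.repr x 0 * b.repr y 0 - n * (b.repr x 1 * b.repr y 1)
      ∧ b.repr (x * y) 1 = b.repr x 0 * b.repr y 1 + b.repr x 1 * b.repr y 0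
        + t * (b.repr x 1 * b.repr y 1) := by
    intro x y
    have : x * y = ((b.repr x 0 * b.repr y 0 - n * (b.repr x 1 * b.repr y 1) : ℤ) : 𝓞 K) +
      ((b.repr x 0 * b.repr y 1 + b.repr x 1 * b.repr y 0
        + t * (b.repr x 1 * b.repr y 1) : ℤ) : 𝓞 K) * b 1 := by
      conv_lhs => rw [qf_repr b hb x, qf_repr b hb y]
      push_cast
      linear_combination ((b.repr x 1 : 𝓞 K) * b.repr y 1) * h
    rw [this]
    exact qf_repr_mk b hb _ _
  have h1 := qf_repr_mk b hb 1 0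
  simp only [Int.cast_one, Int.cast_zero, zero_mul, add_zero] at h1
  refine ⟨{ toFun := fun x => (b.repr x 0 : ZMod p) + b.repr x 1 * r
            map_one' := by rw [h1.1, h1.2]; simp
            map_mul' := ?_
            map_zero' := by simp
            map_add' := ?_ }, ?_⟩
  · intro x y
    rw [(key x y).1, (key x y).2]
    push_cast
    linear_combination (-(b.repr x 1 : ZMod p) * b.repr y 1) * hr
  · intro x y
    simp only [map_add, Finsupp.add_apply]
    push_cast
    ring
  · simp

/-- The kernel of such a homomorphism. -/
lemma qf_ker (b : Module.Basis (Fin 2) ℤ (𝓞 K)) (hb : b 0 = 1) (p : ℕ) [Fact p.Prime]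
    (f : 𝓞 K →+* ZMod p) (r : ℤ) (hr : f (b 1) = r) :
    Ideal.absNorm (RingHom.ker f) = p ∧
    ∀ M : Ideal (𝓞 K), (p : 𝓞 K) ∈ M → b 1 - r ∈ M → RingHom.ker f ≤ M := by
  constructor
  · have hs : Function.Surjective f := ZMod.ringHom_surjective f
    rw [Ideal.absNorm_apply, Submodule.cardQuot_apply]
    rw [Nat.card_congr (RingHom.quotientKerEquivOfSurjective hs).toEquiv, Nat.card_zmod]
  · intro M hp hw x hx
    rw [RingHom.mem_ker] at hx
    rw [qf_repr b hb x] at hx ⊢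
    generalize b.repr x 0 = u at *
    generalize b.repr x 1 = v at *
    rw [map_add, map_mul, map_intCast, map_intCast, hr] at hx
    have hd : (p : ℤ) ∣ u + v * r := by
      rw [← ZMod.intCast_zmod_eq_zero_iff_dvd]
      exact_mod_cast hx
    obtain ⟨c, hc⟩ := hd
    have hc' : (u : 𝓞 K) + v * r = p * c := by exact_mod_cast hc
    have : (u : 𝓞 K) + v * b 1 = c * p + v * (b 1 - r) := by
      linear_combination hc'
    rw [this]
    exact M.add_mem (M.mul_mem_left _ hp) (M.mul_mem_left _ hw)

lemma qf_int_mem {p : ℕ} (hp : p.Prime) (M : Ideal (𝓞 K)) (hM : M ≠ ⊤)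
    (hpM : (p : 𝓞 K) ∈ M) (m : ℤ) (hm : (m : 𝓞 K) ∈ M) : (p : ℤ) ∣ m := by
  by_contra hnd
  have hc : IsCoprime (p : ℤ) m :=
    (Prime.coprime_iff_not_dvd (Nat.prime_iff_prime_int.mp hp)).mpr hnd
  obtain ⟨u, v, huv⟩ := hc
  apply hM
  rw [Ideal.eq_top_iff_one]
  have : (1 : 𝓞 K) = u * p + v * m := by exact_mod_cast huv.symm
  rw [this]
  exact M.add_mem (M.mul_mem_left _ hpM) (M.mul_mem_left _ hm)

/-- Split / ramified case. -/
lemma qf_root (b : Module.Basis (Fin 2) ℤ (𝓞 K)) (hb : b 0 = 1) {t n : ℤ}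
    (h : b 1 * b 1 = t * b 1 - n) (p : ℕ) (hp : p.Prime) (r : ℤ)
    (hr : (p : ℤ) ∣ r * r - t * r + n) :
    ∃ P Q : Ideal (𝓞 K), Ideal.absNorm P = p ∧ Ideal.absNorm Q = p ∧
      (∀ M : Ideal (𝓞 K), M.IsMaximal → (p : 𝓞 K) ∈ M → M = P ∨ M = Q) ∧
      (P = Q ↔ (p : ℤ) ∣ 2 * r - t) := by
  have : Fact p.Prime := ⟨hp⟩
  have hr1 : (r : ZMod p) * r - t * r + n = 0 := by
    have := (ZMod.intCast_zmod_eq_zero_iff_dvd _ p).mpr hr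
    exact_mod_cast this
  obtain ⟨f, hf⟩ := qf_hom b hb h p (r : ZMod p) (by linear_combination hr1)
  obtain ⟨g, hg⟩ := qf_hom b hb h p ((t - r : ℤ) : ZMod p) (by push_cast; linear_combination hr1)
  obtain ⟨nf, kf⟩ := qf_ker b hb p f r hf
  obtain ⟨ng, kg⟩ := qf_ker b hb p g (t - r) hg
  have mf : (RingHom.ker f).IsMaximal :=
    RingHom.ker_isMaximal_of_surjective f (ZMod.ringHom_surjective f)
  have mg : (RingHom.ker g).IsMaximal :=
    RingHom.ker_isMaximal_of_surjective g (ZMod.ringHom_surjective g)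
  refine ⟨RingHom.ker f, RingHom.ker g, nf, ng, ?_, ?_⟩
  · intro M hM hpM
    have hmem : (b 1 - r) * (b 1 - (t - r : ℤ)) ∈ M := by
      obtain ⟨c, hc⟩ := hr
      have hc' : (r : 𝓞 K) * r - t * r + n = p * c := by exact_mod_cast hc
      have : (b 1 - r) * (b 1 - (t - r : ℤ)) = (-c : 𝓞 K) * p := by
        push_cast
        linear_combination h - hc'
      rw [this]
      exact M.mul_mem_left _ hpM
    rcases hM.isPrime.mem_or_mem hmem with h1 | h1
    · exact Or.inl (mf.eq_of_le hM.ne_top (kf M hpM h1)).symm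
    · exact Or.inr (mg.eq_of_le hM.ne_top (kg M hpM h1)).symm
  · constructor
    · intro he
      have h1 : b 1 - r ∈ RingHom.ker g := by
        rw [← he, RingHom.mem_ker, map_sub, hf, map_intCast, sub_self]
      rw [RingHom.mem_ker, map_sub, hg, map_intCast] at h1
      rw [← ZMod.intCast_zmod_eq_zero_iff_dvd]
      push_cast at h1 ⊢
      linear_combination -h1
    · intro hd
      refine mf.eq_of_le mg.ne_top (kf _ ?_ ?_)
      · rw [RingHom.mem_ker, map_natCast, ZMod.natCast_self]
      · rw [← ZMod.intCast_zmod_eq_zero_iff_dvd] at hd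
        rw [RingHom.mem_ker, map_sub, hg, map_intCast]
        push_cast at hd ⊢
        linear_combination -hd

/-- Inert case. -/
lemma qf_noroot (b : Module.Basis (Fin 2) ℤ (𝓞 K)) (hb : b 0 = 1) {t n : ℤ}
    (h : b 1 * b 1 = t * b 1 - n) (p : ℕ) (hp : p.Prime)
    (hr : ∀ r : ℤ, ¬ (p : ℤ) ∣ r * r - t * r + n) 
    (M : Ideal (𝓞 K)) (hM : M.IsMaximal) (hpM : (p : 𝓞 K) ∈ M) :
    M = Ideal.span {(p : 𝓞 K)} := by
  apply le_antisymm
  · intro x hx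
    have key := qf_repr b hb x
    generalize b.repr x 0 = u at *
    generalize b.repr x 1 = v at *
    have hv : (p : ℤ) ∣ v := by
      by_contra hnd
      have hc : IsCoprime (p : ℤ) v :=
        (Prime.coprime_iff_not_dvd (Nat.prime_iff_prime_int.mp hp)).mpr hnd
      obtain ⟨c, d, hcd⟩ := hc
      have hcd' : (c : 𝓞 K) * p + d * v = 1 := by exact_mod_cast hcd
      have h1 : b 1 + d * u ∈ M := by
        have : b 1 + d * u = d * x + (b 1 * c) * p := by
          rw [key]
          linear_combination (- b 1) * hcd'
        rw [this]
        exact M.add_mem (M.mul_mem_left _ hx) (M.mul_mem_left _ hpM)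
      refine hr (-(d * u)) (qf_int_mem hp M hM.ne_top hpM _ ?_)
      have : ((-(d * u) * -(d * u) - t * -(d * u) + n : ℤ) : 𝓞 K) =
          (t - b 1 + d * u) * (b 1 + d * u) := by
        push_cast
        linear_combination h
      rw [this]
      exact M.mul_mem_left _ h1
    obtain ⟨v', rfl⟩ := hv
    have hu : (p : ℤ) ∣ u := by
      apply qf_int_mem hp M hM.ne_top hpM
      have : (u : 𝓞 K) = x - (v' * b 1) * p := by
        rw [key]; push_cast; ring
      rw [this]
      exact M.sub_mem hx (M.mul_mem_left _ hpM)
    obtain ⟨u', rfl⟩ := hu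
    rw [Ideal.mem_span_singleton]
    exact ⟨u' + v' * b 1, by rw [key]; push_cast; ring⟩
  · rw [Ideal.span_singleton_le_iff_mem]
    exact hpM

/-- The set of ideals of norm `n`. -/
def qfS (K : Type*) [Field K] [NumberField K] (n : ℕ) : Set (Ideal (𝓞 K)) :=
  {I | Ideal.absNorm I = n}

lemma qfS_finite (n : ℕ) : (qfS K n).Finite := Ideal.finite_setOfPred_absNorm_eq n

lemma qfS_one : (qfS K 1).ncard = 1 := by
  have : qfS K 1 = {⊤} := by
    ext I
    simp [qfS, Ideal.absNorm_eq_one_iff]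
  rw [this, Set.ncard_singleton]

lemma qf_sup_eq {m n : ℕ} (hmn : m.Coprime n) (J J' : Ideal (𝓞 K))
    (hJ : Ideal.absNorm J = m) (hJ' : Ideal.absNorm J' = n) :
    J * J' ⊔ Ideal.span {(m : 𝓞 K)} = J := by
  have h1 : J ∣ Ideal.span {(m : 𝓞 K)} := by
    rw [Ideal.dvd_span_singleton, ← hJ]
    exact Ideal.absNorm_mem J
  obtain ⟨C, hC⟩ := h1
  have h2 : J' ⊔ C = ⊤ := by
    rw [Ideal.eq_top_iff_one]
    have hm : (m : 𝓞 K) ∈ J' ⊔ C := by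
      apply Ideal.mem_sup_right
      have : (m : 𝓞 K) ∈ J * C := by rw [← hC]; exact Ideal.mem_span_singleton_self _
      exact (Ideal.mul_le_right : J * C ≤ C) this
    have hn : (n : 𝓞 K) ∈ J' ⊔ C := by
      apply Ideal.mem_sup_left
      rw [← hJ']
      exact Ideal.absNorm_mem J'
    obtain ⟨u, v, huv⟩ := Nat.isCoprime_iff_coprime.mpr hmn
    have : (1 : 𝓞 K) = u * m + v * n := by exact_mod_cast huv.symm
    rw [this]
    exact Ideal.add_mem _ (Ideal.mul_mem_left _ _ hm) (Ideal.mul_mem_left _ _ hn)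
  rw [hC, ← Ideal.mul_sup, h2, Ideal.mul_top]

lemma qf_norm_sup (hK : Module.finrank ℚ K = 2) {m n : ℕ} (hmn : m.Coprime n)
    (I : Ideal (𝓞 K)) (hI : Ideal.absNorm I = m * n) :
    Ideal.absNorm (I ⊔ Ideal.span {(m : 𝓞 K)}) ∣ m := by
  have hfr : Module.finrank ℤ (𝓞 K) = 2 := by rw [RingOfIntegers.rank, hK]
  have h1 : Ideal.absNorm (I ⊔ Ideal.span {(m : 𝓞 K)}) ∣ m ^ 2 := by
    have := Ideal.absNorm_dvd_absNorm_of_le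
      (le_sup_right : Ideal.span {(m : 𝓞 K)} ≤ I ⊔ Ideal.span {(m : 𝓞 K)})
    rwa [Ideal.absNorm_span_natCast, hfr] at this
  have h2 : Ideal.absNorm (I ⊔ Ideal.span {(m : 𝓞 K)}) ∣ m * n := by
    rw [← hI]
    exact Ideal.absNorm_dvd_absNorm_of_le le_sup_left
  have h3 : (Ideal.absNorm (I ⊔ Ideal.span {(m : 𝓞 K)})).Coprime n :=
    Nat.Coprime.coprime_dvd_left h1 (Nat.Coprime.pow_left 2 hmn)
  exact h3.dvd_of_dvd_mul_right h2

lemma qfS_mul (hK : Module.finrank ℚ K = 2) {m n : ℕ} (hm : m ≠ 0) (hn : n ≠ 0)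
    (hmn : m.Coprime n) :
    (qfS K (m * n)).ncard = (qfS K m).ncard * (qfS K n).ncard := by
  rw [← Set.ncard_prod]
  symm
  refine Set.ncard_congr (fun x _ => x.1 * x.2) ?_ ?_ ?_
  · rintro ⟨J, J'⟩ ⟨hJ, hJ'⟩
    simp only [qfS, Set.mem_ofPred_eq] at hJ hJ' ⊢
    rw [map_mul, hJ, hJ']
  · rintro ⟨J, J'⟩ ⟨L, L'⟩ ⟨hJ, hJ'⟩ ⟨hL, hL'⟩ he
    simp only [qfS, Set.mem_ofPred_eq] at hJ hJ' hL hL' he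
    have e1 : J = L := by
      rw [← qf_sup_eq hmn J J' hJ hJ', he, qf_sup_eq hmn L L' hL hL']
    have e2 : J' = L' := by
      rw [← qf_sup_eq hmn.symm J' J hJ' hJ, mul_comm, he, mul_comm,
        qf_sup_eq hmn.symm L' L hL' hL]
    rw [e1, e2]
  · intro I hI
    simp only [qfS, Set.mem_ofPred_eq] at hI
    have hd1 := qf_norm_sup hK hmn I hI
    have hd2 := qf_norm_sup hK hmn.symm I (by rw [hI, mul_comm])
    have hprod : (I ⊔ Ideal.span {(m : 𝓞 K)}) * (I ⊔ Ideal.span {(n : 𝓞 K)}) = I := by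
      apply le_antisymm
      · rw [Ideal.sup_mul, Ideal.mul_sup, Ideal.mul_sup]
        refine sup_le (sup_le Ideal.mul_le_left Ideal.mul_le_left)
          (sup_le Ideal.mul_le_right ?_)
        rw [Ideal.span_singleton_mul_span_singleton, Ideal.span_singleton_le_iff_mem]
        have := Ideal.absNorm_mem I
        rw [hI] at this
        exact_mod_cast this
      · intro x hx
        obtain ⟨u, v, huv⟩ := Nat.isCoprime_iff_coprime.mpr hmn
        have h1 : (1 : 𝓞 K) = u * m + v * n := by exact_mod_cast huv.symm
        have : x = (u * m) * x + x * (v * n) := by linear_combination x * h1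
        rw [this]
        refine Ideal.add_mem _ (Ideal.mul_mem_mul ?_ ?_) (Ideal.mul_mem_mul ?_ ?_)
        · exact Ideal.mem_sup_right (Ideal.mul_mem_left _ _ (Ideal.mem_span_singleton_self _))
        · exact Ideal.mem_sup_left hx
        · exact Ideal.mem_sup_left hx
        · exact Ideal.mem_sup_right (Ideal.mul_mem_left _ _ (Ideal.mem_span_singleton_self _))
    refine ⟨(I ⊔ Ideal.span {(m : 𝓞 K)}, I ⊔ Ideal.span {(n : 𝓞 K)}), ?_, hprod⟩
    have hN := congrArg Ideal.absNorm hprod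
    rw [map_mul, hI] at hN
    have l1 := Nat.le_of_dvd (Nat.pos_of_ne_zero hm) hd1
    have l2 := Nat.le_of_dvd (Nat.pos_of_ne_zero hn) hd2
    have pm := Nat.pos_of_ne_zero hm
    have pn := Nat.pos_of_ne_zero hn
    simp only [qfS, Set.mem_prod, Set.mem_ofPred_eq]
    constructor
    · refine le_antisymm l1 ?_
      by_contra hlt
      push Not at hlt
      nlinarith
    · refine le_antisymm l2 ?_
      by_contra hlt
      push Not at hlt
      nlinarith

lemma qf_exists_max {p : ℕ} (hp : p.Prime) (k : ℕ) (I : Ideal (𝓞 K))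
    (hI : Ideal.absNorm I = p ^ (k + 1)) :
    ∃ M J : Ideal (𝓞 K), M.IsMaximal ∧ (p : 𝓞 K) ∈ M ∧ I = M * J := by
  have hne : I ≠ ⊤ := by
    intro h
    rw [h, Ideal.absNorm_top] at hI
    have h1 : 1 < p ^ (k + 1) := Nat.one_lt_pow (Nat.succ_ne_zero k) hp.one_lt
    exact absurd hI h1.ne
  obtain ⟨M, hM, hIM⟩ := Ideal.exists_le_maximal I hne
  have hpM : (p : 𝓞 K) ∈ M := by
    have := hIM (Ideal.absNorm_mem I)
    rw [hI, Nat.cast_pow] at this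
    exact hM.isPrime.mem_of_pow_mem _ this
  obtain ⟨J, hJ⟩ := Ideal.dvd_iff_le.mpr hIM
  exact ⟨M, J, hM, hpM, hJ⟩

lemma qf_image_ncard (P : Ideal (𝓞 K)) (hP : Ideal.absNorm P ≠ 0) (n : ℕ) :
    ((fun J => P * J) '' qfS K n).ncard = (qfS K n).ncard := by
  apply Set.ncard_image_of_injective
  have hP0 : P ≠ 0 := by
    rintro rfl
    simp at hP
  exact mul_right_injective₀ hP0

lemma qfS_inert {p : ℕ} (hp : p.Prime) (P : Ideal (𝓞 K)) (hP : Ideal.absNorm P = p ^ 2)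
    (hM : ∀ M : Ideal (𝓞 K), M.IsMaximal → (p : 𝓞 K) ∈ M → M = P) :
    (qfS K (p ^ 1)).ncard = 0 ∧
      ∀ k, (qfS K (p ^ (k + 2))).ncard = (qfS K (p ^ k)).ncard := by
  have h2 := hp.two_le
  constructor
  · have : qfS K (p ^ 1) = ∅ := by
      rw [Set.eq_empty_iff_forall_notMem]
      intro I hI
      simp only [qfS, Set.mem_ofPred_eq] at hI
      obtain ⟨M, J, hMm, hpM, rfl⟩ := qf_exists_max hp 0 I hI
      rw [hM M hMm hpM, map_mul, hP, pow_one] at hI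
      have h3 : p * (p * Ideal.absNorm J) = p * 1 := by rw [mul_one]; nlinarith
      have h4 := Nat.eq_of_mul_eq_mul_left hp.pos h3
      have := Nat.dvd_one.mp ⟨_, h4.symm⟩
      omega
    rw [this, Set.ncard_empty]
  · intro k
    rw [← qf_image_ncard P (by rw [hP]; positivity) (p ^ k)]
    congr 1
    ext I
    simp only [qfS, Set.mem_ofPred_eq, Set.mem_image]
    constructor
    · intro hI
      obtain ⟨M, J, hMm, hpM, rfl⟩ := qf_exists_max hp (k + 1) I hI
      rw [hM M hMm hpM] at hI ⊢
      refine ⟨J, ?_, rfl⟩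
      rw [map_mul, hP, pow_add, mul_comm (p ^ k)] at hI
      exact Nat.eq_of_mul_eq_mul_left (by positivity) hI
    · rintro ⟨J, hJ, rfl⟩
      rw [map_mul, hJ, hP]
      ring

lemma qfS_ram {p : ℕ} (hp : p.Prime) (P : Ideal (𝓞 K)) (hP : Ideal.absNorm P = p)
    (hM : ∀ M : Ideal (𝓞 K), M.IsMaximal → (p : 𝓞 K) ∈ M → M = P) (k : ℕ) :
    (qfS K (p ^ (k + 1))).ncard = (qfS K (p ^ k)).ncard := by
  rw [← qf_image_ncard P (by rw [hP]; exact hp.ne_zero) (p ^ k)]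
  congr 1
  ext I
  simp only [qfS, Set.mem_ofPred_eq, Set.mem_image]
  constructor
  · intro hI
    obtain ⟨M, J, hMm, hpM, rfl⟩ := qf_exists_max hp k I hI
    rw [hM M hMm hpM] at hI ⊢
    refine ⟨J, ?_, rfl⟩
    rw [map_mul, hP, pow_succ, mul_comm (p ^ k)] at hI
    exact Nat.eq_of_mul_eq_mul_left hp.pos hI
  · rintro ⟨J, hJ, rfl⟩
    rw [map_mul, hJ, hP]
    ring

lemma qf_eq_pow {p : ℕ} (hp : p.Prime) (P Q : Ideal (𝓞 K))
    (hQ : Ideal.absNorm Q = p)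
    (hM : ∀ M : Ideal (𝓞 K), M.IsMaximal → (p : 𝓞 K) ∈ M → M = P ∨ M = Q) (k : ℕ) :
    ∀ I : Ideal (𝓞 K), Ideal.absNorm I = p ^ k → ¬ P ∣ I → I = Q ^ k := by
  induction k with
  | zero =>
    intro I hI _
    rw [pow_zero, Ideal.absNorm_eq_one_iff] at hI
    rw [hI, pow_zero, Ideal.one_eq_top]
  | succ k ih =>
    intro I hI hd
    obtain ⟨M, J, hMm, hpM, rfl⟩ := qf_exists_max hp k I hI
    rcases hM M hMm hpM with rfl | rfl
    · exact absurd (dvd_mul_right _ _) hd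
    · rw [map_mul, hQ, pow_succ, mul_comm (p ^ k)] at hI
      rw [ih J (Nat.eq_of_mul_eq_mul_left hp.pos hI) (fun h => hd (h.mul_left _)), pow_succ,
        mul_comm]

lemma qfS_split {p : ℕ} (hp : p.Prime) (P Q : Ideal (𝓞 K)) (hP : Ideal.absNorm P = p)
    (hQ : Ideal.absNorm Q = p) (hPQ : P ≠ Q)
    (hM : ∀ M : Ideal (𝓞 K), M.IsMaximal → (p : 𝓞 K) ∈ M → M = P ∨ M = Q) (k : ℕ) :
    (qfS K (p ^ (k + 1))).ncard = (qfS K (p ^ k)).ncard + 1 := by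
  have hP0 : P ≠ ⊥ := by
    rintro rfl
    rw [Ideal.absNorm_bot] at hP
    exact hp.ne_zero hP.symm
  have hQ0 : Q ≠ ⊥ := by
    rintro rfl
    rw [Ideal.absNorm_bot] at hQ
    exact hp.ne_zero hQ.symm
  have hPp : P.IsPrime := Ideal.isPrime_of_irreducible_absNorm (by rw [hP]; exact hp)
  have hQp : Q.IsPrime := Ideal.isPrime_of_irreducible_absNorm (by rw [hQ]; exact hp)
  have hnd : ∀ j, ¬ P ∣ Q ^ j := by
    intro j hd
    have h1 := (Ideal.prime_of_isPrime hP0 hPp).dvd_of_dvd_pow hd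
    have h2 := Ideal.dvd_iff_le.mp h1
    exact hPQ (((hQp.isMaximal hQ0).eq_of_le hPp.ne_top h2).symm)
  rw [← qf_image_ncard P (by rw [hP]; exact hp.ne_zero) (p ^ k)]
  rw [← Set.ncard_insert_of_notMem (a := Q ^ (k + 1)) ?_ ((qfS_finite _).image _)]
  · congr 1
    ext I
    simp only [qfS, Set.mem_ofPred_eq, Set.mem_image, Set.mem_insert_iff]
    constructor
    · intro hI
      by_cases hd : P ∣ I
      · right
        obtain ⟨J, rfl⟩ := hd
        refine ⟨J, ?_, rfl⟩
        rw [map_mul, hP, pow_succ, mul_comm (p ^ k)] at hI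
        exact Nat.eq_of_mul_eq_mul_left hp.pos hI
      · exact Or.inl (qf_eq_pow hp P Q hQ hM _ I hI hd)
    · rintro (rfl | ⟨J, hJ, rfl⟩)
      · rw [map_pow, hQ]
      · rw [map_mul, hJ, hP]
        ring
  · rintro ⟨J, _, hJ⟩
    exact hnd _ ⟨J, hJ.symm⟩

lemma qf_kron_mul (a : ℤ) {m n : ℕ} (hm : m ≠ 0) (hn : n ≠ 0) :
    kroneckerSym a (m * n) = kroneckerSym a m * kroneckerSym a n := by
  unfold kroneckerSym
  rw [((Nat.perm_primeFactorsList_mul hm hn).map _).prod_eq, List.map_append, List.prod_append]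

lemma qf_kron_one (a : ℤ) : kroneckerSym a 1 = 1 := by
  simp [kroneckerSym]

lemma qf_kron_pow (a : ℤ) {m : ℕ} (hm : m ≠ 0) (k : ℕ) :
    kroneckerSym a (m ^ k) = kroneckerSym a m ^ k := by
  induction k with
  | zero => simp [qf_kron_one]
  | succ k ih => rw [pow_succ, qf_kron_mul a (pow_ne_zero _ hm) hm, ih, pow_succ]

lemma qf_kron_two (a : ℤ) : kroneckerSym a 2 =
    if a % 2 = 0 then 0 else if a % 8 = 1 ∨ a % 8 = 7 then 1 else -1 := by
  simp [kroneckerSym, Nat.primeFactorsList_prime Nat.prime_two, Nat.prime_two]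

lemma qf_kron_prime (a : ℤ) (p : ℕ) [hp : Fact p.Prime] (h2 : p ≠ 2) :
    kroneckerSym a p = legendreSym p a := by
  simp [kroneckerSym, Nat.primeFactorsList_prime hp.out, hp.out, h2]

lemma qf_chi (p : ℕ) (hp : p.Prime) (t n : ℤ) :
    (kroneckerSym (t ^ 2 - 4 * n) p = 0 ∧
      ∃ r : ℤ, (p : ℤ) ∣ r * r - t * r + n ∧ (p : ℤ) ∣ 2 * r - t) ∨
    (kroneckerSym (t ^ 2 - 4 * n) p = 1 ∧
      ∃ r : ℤ, (p : ℤ) ∣ r * r - t * r + n ∧ ¬ (p : ℤ) ∣ 2 * r - t) ∨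
    (kroneckerSym (t ^ 2 - 4 * n) p = -1 ∧
      ∀ r : ℤ, ¬ (p : ℤ) ∣ r * r - t * r + n) := by
  by_cases h2 : p = 2
  · subst h2
    rw [qf_kron_two]
    rcases Int.even_or_odd' t with ⟨s, rfl | rfl⟩
    · left
      refine ⟨by rw [if_pos]; ring_nf; omega, n, ?_, ⟨n - s, by push_cast; ring⟩⟩
      have : Even (n * (n + 1)) := Int.even_mul_succ_self n
      obtain ⟨c, hc⟩ := this
      exact ⟨c - s * n, by push_cast; linear_combination hc⟩
    · obtain ⟨c, hc⟩ := Int.even_mul_succ_self s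
      have hD : (2 * s + 1) ^ 2 - 4 * n = 8 * c + 1 - 4 * n := by linear_combination 4 * hc
      rw [hD]
      rcases Int.even_or_odd' n with ⟨e, rfl | rfl⟩
      · right; left
        refine ⟨?_, 0, ⟨e, by push_cast; ring⟩, ?_⟩
        · rw [if_neg (by omega), if_pos (by omega)]
        · push_cast; omega
      · right; right
        refine ⟨?_, ?_⟩
        · rw [if_neg (by omega), if_neg (by omega)]
        · rintro r ⟨d, hd⟩
          obtain ⟨f, hf⟩ := Int.even_mul_succ_self r
          have : 2 * f - 2 * r - 2 * (s * r) + 2 * e + 1 = 2 * d := by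
            push_cast at hd
            linear_combination hd - hf
          omega
  · have hpF : Fact p.Prime := ⟨hp⟩
    rw [qf_kron_prime _ p h2]
    have h20 : (2 : ZMod p) ≠ 0 := by
      intro h
      have h' : ((2 : ℕ) : ZMod p) = 0 := by exact_mod_cast h
      rw [ZMod.natCast_eq_zero_iff] at h'
      exact h2 ((Nat.prime_dvd_prime_iff_eq hp Nat.prime_two).mp h')
    simp only [← ZMod.intCast_zmod_eq_zero_iff_dvd]
    by_cases h0 : ((t ^ 2 - 4 * n : ℤ) : ZMod p) = 0
    · left
      refine ⟨(legendreSym.eq_zero_iff p _).mpr h0, ?_⟩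
      obtain ⟨r, hr⟩ := ZMod.intCast_surjective ((t : ZMod p) / 2)
      have hr' : 2 * (r : ZMod p) = t := by rw [hr]; field_simp
      refine ⟨r, ?_, ?_⟩
      · push_cast at h0 ⊢
        have h4 : (2 * 2 : ZMod p) ≠ 0 := mul_ne_zero h20 h20
        apply mul_left_cancel₀ h4
        linear_combination (2 * r - t : ZMod p) * hr' - h0
      · push_cast
        linear_combination hr'
    · by_cases hsq : IsSquare ((t ^ 2 - 4 * n : ℤ) : ZMod p)
      · right; left
        refine ⟨(legendreSym.eq_one_iff p h0).mpr hsq, ?_⟩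
        obtain ⟨y, hy⟩ := hsq
        obtain ⟨r, hr⟩ := ZMod.intCast_surjective (((t : ZMod p) + y) / 2)
        have hr' : 2 * (r : ZMod p) = t + y := by rw [hr]; field_simp
        refine ⟨r, ?_, ?_⟩
        · push_cast at hy ⊢
          have h4 : (2 * 2 : ZMod p) ≠ 0 := mul_ne_zero h20 h20
          apply mul_left_cancel₀ h4
          linear_combination (2 * r - t + y : ZMod p) * hr' - hy
        · intro h
          apply h0
          rw [hy]
          have : y = 0 := by
            push_cast at h
            linear_combination h - hr'
          rw [this, mul_zero]
      · right; right
        refine ⟨(legendreSym.eq_neg_one_iff p).mpr hsq, ?_⟩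
        intro r hr
        apply hsq
        refine ⟨2 * r - t, ?_⟩
        push_cast at hr ⊢
        linear_combination (-4) * hr

lemma qfS_prime_pow (hK : Module.finrank ℚ K = 2) (p : ℕ) (hp : p.Prime) (k : ℕ) :
    ((qfS K (p ^ k)).ncard : ℤ) =
      ∑ i ∈ Finset.range (k + 1), kroneckerSym (NumberField.discr K) p ^ i := by
  have hfr : Module.finrank ℤ (𝓞 K) = 2 := by rw [RingOfIntegers.rank, hK]
  obtain ⟨b, hb⟩ := qf_exists_basis hK
  obtain ⟨t, n, h, hD⟩ := qf_discr b hb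
  rw [hD]
  rcases qf_chi p hp t n with ⟨hc, r, hr, hr2⟩ | ⟨hc, r, hr, hr2⟩ | ⟨hc, hr⟩
  · rw [hc]
    obtain ⟨P, Q, hP, hQ, hM, hPQ⟩ := qf_root b hb h p hp r hr
    obtain rfl := hPQ.mpr hr2
    simp only [or_self] at hM
    have : (qfS K (p ^ k)).ncard = 1 := by
      induction k with
      | zero => rw [pow_zero, qfS_one]
      | succ k ih => rw [qfS_ram hp P hP hM k, ih]
    rw [this, Finset.sum_range_succ']
    simp
  · rw [hc]
    obtain ⟨P, Q, hP, hQ, hM, hPQ⟩ := qf_root b hb h p hp r hr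
    have hne : P ≠ Q := fun he => hr2 (hPQ.mp he)
    have : (qfS K (p ^ k)).ncard = k + 1 := by
      induction k with
      | zero => rw [pow_zero, qfS_one]
      | succ k ih => rw [qfS_split hp P Q hP hQ hne hM k, ih]
    rw [this]
    simp
  · rw [hc]
    have hM := qf_noroot b hb h p hp hr
    have hN := Ideal.absNorm_span_natCast (S := 𝓞 K) p
    rw [hfr] at hN
    obtain ⟨h1, hk⟩ := qfS_inert hp _ hN hM
    induction k using Nat.twoStepInduction with
    | zero => rw [pow_zero, qfS_one]; simp
    | one => rw [h1]; simp [Finset.sum_range_succ]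
    | more k ih _ =>
      rw [hk, ih, Finset.sum_range_succ _ (k + 2), Finset.sum_range_succ _ (k + 1)]
      ring

lemma qf_kron_abs (a : ℤ) (n : ℕ) : |kroneckerSym a n| ≤ 1 := by
  have key : ∀ l : List ℕ, (∀ p ∈ l, p.Prime) → |(l.map (fun p =>
    if hp : p.Prime then
      (if p = 2 then
        (if a % 2 = 0 then 0 else if a % 8 = 1 ∨ a % 8 = 7 then 1 else -1)
      else @legendreSym p ⟨hp⟩ a)
    else 0)).prod| ≤ 1 := by
    intro l
    induction l with
    | nil => simp
    | cons p l ih =>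
      intro hl
      rw [List.map_cons, List.prod_cons, abs_mul]
      refine mul_le_one₀ ?_ (abs_nonneg _) (ih fun q hq => hl q (List.mem_cons_of_mem _ hq))
      have hp : p.Prime := hl p List.mem_cons_self
      rw [dif_pos hp]
      have hpF : Fact p.Prime := ⟨hp⟩
      split_ifs
      · simp
      · simp
      · simp
      · by_cases h0 : (a : ZMod p) = 0
        · rw [(legendreSym.eq_zero_iff p a).mpr h0]; simp
        · rcases legendreSym.eq_one_or_neg_one p h0 with h | h <;> rw [h] <;> simp
  exact key _ fun p hp => Nat.prime_of_mem_primeFactorsList hp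

/-- Ideal counting function as an arithmetic function. -/
noncomputable def qfA (K : Type*) [Field K] [NumberField K] : ArithmeticFunction ℂ :=
  ⟨fun n => if n = 0 then 0 else ((qfS K n).ncard : ℂ), by simp⟩

/-- Kronecker symbol as an arithmetic function. -/
noncomputable def qfX (a : ℤ) : ArithmeticFunction ℂ :=
  ⟨fun n => if n = 0 then 0 else (kroneckerSym a n : ℂ), by simp⟩

lemma qfA_apply {n : ℕ} (hn : n ≠ 0) : qfA K n = ((qfS K n).ncard : ℂ) := by
  simp [qfA, hn]

lemma qfX_apply (a : ℤ) {n : ℕ} (hn : n ≠ 0) : qfX a n = (kroneckerSym a n : ℂ) := by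
  simp [qfX, hn]

lemma qfA_mult (hK : Module.finrank ℚ K = 2) : (qfA K).IsMultiplicative := by
  rw [ArithmeticFunction.IsMultiplicative.iff_ne_zero]
  refine ⟨by rw [qfA_apply one_ne_zero, qfS_one]; simp, ?_⟩
  intro m n hm hn hmn
  rw [qfA_apply hm, qfA_apply hn, qfA_apply (mul_ne_zero hm hn), qfS_mul hK hm hn hmn]
  push_cast
  rfl

lemma qfX_mult (a : ℤ) : (qfX a).IsMultiplicative := by
  rw [ArithmeticFunction.IsMultiplicative.iff_ne_zero]
  refine ⟨by rw [qfX_apply a one_ne_zero, qf_kron_one]; simp, ?_⟩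
  intro m n hm hn _
  rw [qfX_apply a hm, qfX_apply a hn, qfX_apply a (mul_ne_zero hm hn), qf_kron_mul a hm hn]
  push_cast
  rfl

lemma qfA_eq (hK : Module.finrank ℚ K = 2) :
    qfA K = (ArithmeticFunction.zeta : ArithmeticFunction ℂ) * qfX (NumberField.discr K) := by
  rw [ArithmeticFunction.IsMultiplicative.eq_iff_eq_on_prime_powers _ (qfA_mult hK) _
    (ArithmeticFunction.isMultiplicative_zeta.natCast.mul (qfX_mult _))]
  intro p k hp
  rw [ArithmeticFunction.coe_zeta_mul_apply, Nat.sum_divisors_prime_pow hp,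
    qfA_apply (pow_ne_zero _ hp.ne_zero)]
  have h := qfS_prime_pow hK p hp k
  have h' : ((qfS K (p ^ k)).ncard : ℂ) =
      ((∑ i ∈ Finset.range (k + 1), kroneckerSym (NumberField.discr K) p ^ i : ℤ) : ℂ) := by
    rw [← h]; simp
  rw [h']
  push_cast
  refine Finset.sum_congr rfl fun i _ => ?_
  rw [qfX_apply _ (pow_ne_zero _ hp.ne_zero), qf_kron_pow _ hp.ne_zero]
  push_cast
  rfl

lemma qfX_summable (a : ℤ) {s : ℂ} (hs : 1 < s.re) : LSeriesSummable (fun n => qfX a n) s := by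
  refine LSeriesSummable_of_bounded_of_one_lt_re (m := 1) (fun n hn => ?_) hs
  rw [qfX_apply a hn, Complex.norm_intCast]
  exact_mod_cast qf_kron_abs a n

lemma qfX_LSeries (a : ℤ) {s : ℂ} (hs : 1 < s.re) :
    LSeries (fun n => qfX a n) s = ∑' n : ℕ, (kroneckerSym a n : ℂ) / (n : ℂ) ^ s := by
  unfold LSeries
  refine tsum_congr fun n => ?_
  rw [LSeries.term_def]
  split_ifs with hn
  · subst hn
    have : s ≠ 0 := by
      rintro rfl
      simp at hs
      linarith
    simp [Complex.zero_cpow this]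
  · rw [qfX_apply a hn]

lemma qf_zetaK_eq {s : ℂ} (hA : LSeriesSummable (fun n => qfA K n) s) :
    zetaK K s = LSeries (fun n => qfA K n) s := by
  let N : {I : Ideal (𝓞 K) // I ≠ ⊥} → ℕ := fun I => Ideal.absNorm I.1
  let e := Equiv.sigmaFiberEquiv N
  have hfin : ∀ n, Finite {I : {I : Ideal (𝓞 K) // I ≠ ⊥} // N I = n} := by
    intro n
    have : Finite (qfS K n) := qfS_finite n
    refine Finite.of_injective
      (fun I => (⟨I.1.1, I.2⟩ : qfS K n)) ?_
    intro I J h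
    have h2 := congrArg (fun x : qfS K n => (x : Ideal (𝓞 K))) h
    exact Subtype.ext (Subtype.ext h2)
  have hcard : ∀ n, n ≠ 0 → Nat.card {I : {I : Ideal (𝓞 K) // I ≠ ⊥} // N I = n}
      = (qfS K n).ncard := by
    intro n hn
    rw [← Nat.card_coe_set_eq]
    refine Nat.card_congr (Equiv.ofBijective (fun I => (⟨I.1.1, I.2⟩ : qfS K n)) ⟨?_, ?_⟩)
    · intro I J h
      have h2 := congrArg (fun x : qfS K n => (x : Ideal (𝓞 K))) h
      exact Subtype.ext (Subtype.ext h2)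
    · rintro ⟨I, hI⟩
      refine ⟨⟨⟨I, ?_⟩, hI⟩, rfl⟩
      rintro rfl
      simp only [qfS, Set.mem_ofPred_eq, Ideal.absNorm_bot] at hI
      exact hn hI.symm
  have hempty : IsEmpty {I : {I : Ideal (𝓞 K) // I ≠ ⊥} // N I = 0} := by
    refine ⟨fun I => I.1.2 ?_⟩
    exact Ideal.absNorm_eq_zero_iff.mp I.2
  have hterm : ∀ n, ∑' I : {I : {I : Ideal (𝓞 K) // I ≠ ⊥} // N I = n},
      ((N I.1 : ℕ) : ℂ) ^ (-s) = LSeries.term (fun n => qfA K n) s n := by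
    intro n
    have h1 : ∀ I : {I : {I : Ideal (𝓞 K) // I ≠ ⊥} // N I = n},
      ((N I.1 : ℕ) : ℂ) ^ (-s) = (n : ℂ) ^ (-s) := fun I => by rw [I.2]
    rw [tsum_congr h1, tsum_const]
    rw [LSeries.term_def₀ (by simp)]
    by_cases hn : n = 0
    · subst hn
      simp [Nat.card_of_isEmpty]
    · rw [hcard n hn, qfA_apply hn, nsmul_eq_mul]
  have hnorm : ∀ n, ∑' I : {I : {I : Ideal (𝓞 K) // I ≠ ⊥} // N I = n},
      ‖((N I.1 : ℕ) : ℂ) ^ (-s)‖ = ‖LSeries.term (fun n => qfA K n) s n‖ := by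
    intro n
    have h1 : ∀ I : {I : {I : Ideal (𝓞 K) // I ≠ ⊥} // N I = n},
      ‖((N I.1 : ℕ) : ℂ) ^ (-s)‖ = ‖(n : ℂ) ^ (-s)‖ := fun I => by rw [I.2]
    rw [tsum_congr h1, tsum_const]
    rw [LSeries.term_def₀ (by simp)]
    by_cases hn : n = 0
    · subst hn
      simp [Nat.card_of_isEmpty]
    · rw [hcard n hn, qfA_apply hn, nsmul_eq_mul, norm_mul, Complex.norm_natCast]
  have hsum : Summable (fun x : Σ n, {I : {I : Ideal (𝓞 K) // I ≠ ⊥} // N I = n} =>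
      ((N x.2.1 : ℕ) : ℂ) ^ (-s)) := by
    apply Summable.of_norm
    rw [summable_sigma_of_nonneg (fun x => norm_nonneg _)]
    refine ⟨fun n => ?_, ?_⟩
    · have := hfin n
      exact Summable.of_finite
    · simp only [hnorm]
      exact hA.norm
  unfold zetaK LSeries
  rw [← e.tsum_eq]
  change ∑' x : Σ n, {I : {I : Ideal (𝓞 K) // I ≠ ⊥} // N I = n}, ((N x.2.1 : ℕ) : ℂ) ^ (-s) = _
  rw [hsum.tsum_sigma]
  exact tsum_congr hterm

end QuadraticAux
/-- For a quadratic number field `K` of discriminant `q` and `Re(s) > 1`,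
`ζ_K(s) = ζ(s)·L(s, χ_q)` with `χ_q` the Kronecker symbol of `q`. -/
theorem zetaK_quadratic_factorization (K : Type*) [Field K] [NumberField K]
    (hK : Module.finrank ℚ K = 2) (q : ℤ) (hq : q = NumberField.discr K)
    (s : ℂ) (hs : 1 < s.re) :
    zetaK K s = riemannZeta s * ∑' n : ℕ, (kroneckerSym q n : ℂ) / (n : ℂ) ^ s := by
  subst hq
  have hz : LSeriesSummable (fun n => (ArithmeticFunction.zeta : ArithmeticFunction ℂ) n) s := by
    have := ArithmeticFunction.LSeriesSummable_zeta_iff.mpr hs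
    simpa using this
  have hx := qfX_summable (NumberField.discr K) hs
  have hA : LSeriesSummable (fun n => qfA K n) s := by
    rw [qfA_eq hK]
    exact ArithmeticFunction.LSeriesSummable_mul hz hx
  rw [qf_zetaK_eq hA, qfA_eq hK, ArithmeticFunction.LSeries_mul' hz hx, qfX_LSeries _ hs]
  congr 1
  have := ArithmeticFunction.LSeries_zeta_eq_riemannZeta hs
  rw [← this]
  rfl
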